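/- arXiv:0803.0757 — 2 statements merged into one kernel-verified Lean document; each statement's English description precedes it below -/
import Mathlib

section
/- Let (M_k)_{k=1,…,N} be Hermitian d×d complex matrices, let ρ₁,…,ρ_m be density matrices on ℂ^d, let p₁,…,p_m ≥ 0 with Σ_k p_k = 1, and set ρ = Σ_k p_k ρ_k. Then γ(ρ,{M_k}) − Σ_k p_k γ(ρ_k,{M_k}) is positive semidefinite; the same holds for the symmetric covariance matrices γ^S. -/
open Matrix BigOperators
open scoped ComplexOrder

noncomputable section

/-- Expectation value ⟨X⟩ = tr(ρ X). -/
def expVal {n : Type*} [Fintype n] (ρ X : Matrix n n ℂ) : ℂ := (ρ * X).trace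

/-- The (non-symmetric) covariance matrix of a family of observables. -/
def covMat {n ι : Type*} [Fintype n] [Fintype ι]
    (ρ : Matrix n n ℂ) (M : ι → Matrix n n ℂ) : Matrix ι ι ℂ :=
  Matrix.of fun i j => expVal ρ (M i * M j) - expVal ρ (M i) * expVal ρ (M j)

/-- The symmetric covariance matrix of a family of observables. -/
def symCovMat {n ι : Type*} [Fintype n] [Fintype ι]
    (ρ : Matrix n n ℂ) (M : ι → Matrix n n ℂ) : Matrix ι ι ℂ :=
  Matrix.of fun i j =>
    (expVal ρ (M i * M j) + expVal ρ (M j * M i)) / 2 - expVal ρ (M i) * expVal ρ (M j)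

/-- The covariance of real-valued classical random variables `a · i` under the distribution `p`
is positive semidefinite. -/
theorem posSemidef_classicalCov {κ ι : Type*} [Fintype κ] [Fintype ι]
    (p : κ → ℝ) (hp : ∀ k, 0 ≤ p k) (hp1 : ∑ k, p k = 1)
    (a : κ → ι → ℂ) (ha : ∀ k i, star (a k i) = a k i) :
    (Matrix.of fun i j => ∑ k, (p k : ℂ) * (a k i * a k j)
      - (∑ k, (p k : ℂ) * a k i) * ∑ k, (p k : ℂ) * a k j).PosSemidef := by
  set b : ι → ℂ := fun i => ∑ k, (p k : ℂ) * a k i with hb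
  have hp1' : ∑ k, (p k : ℂ) = 1 := by exact_mod_cast hp1
  have hbstar : ∀ i, star (b i) = b i := fun i => by
    simp only [hb, star_sum, star_mul', ha, Complex.star_def, Complex.conj_ofReal]
  have hsum : (Matrix.of fun i j => ∑ k, (p k : ℂ) * (a k i * a k j) - b i * b j)
      = ∑ k, (p k : ℂ) • vecMulVec (a k - b) (star (a k - b)) := by
    ext i j
    have hexp : ∀ k, (p k : ℂ) * ((a k i - b i) * (a k j - b j))
        = (p k : ℂ) * (a k i * a k j) - ((p k : ℂ) * a k i) * b j - b i * ((p k : ℂ) * a k j)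
          + (p k : ℂ) * (b i * b j) := fun k => by ring
    simp only [Matrix.of_apply, Matrix.sum_apply, Matrix.smul_apply, vecMulVec_apply,
      Pi.sub_apply, Pi.star_apply, star_sub, ha, hbstar, smul_eq_mul, hexp,
      Finset.sum_add_distrib, Finset.sum_sub_distrib, ← Finset.sum_mul, ← Finset.mul_sum, hp1']
    change _ = _ - b i * b j - b i * b j + _
    ring
  rw [hsum]
  exact Matrix.posSemidef_sum _ fun k _ =>
    (posSemidef_vecMulVec_self_star _).smul (by exact_mod_cast hp k)

theorem star_expVal {n : Type*} [Fintype n] {ρ X : Matrix n n ℂ}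
    (hρ : ρ.IsHermitian) (hX : X.IsHermitian) : star (expVal ρ X) = expVal ρ X := by
  rw [expVal, ← trace_conjTranspose, conjTranspose_mul, hρ.eq, hX.eq, trace_mul_comm]

theorem expVal_sum_smul {n κ : Type*} [Fintype n] [Fintype κ]
    (c : κ → ℂ) (ρ : κ → Matrix n n ℂ) (X : Matrix n n ℂ) :
    expVal (∑ k, c k • ρ k) X = ∑ k, c k * expVal (ρ k) X := by
  simp [expVal, Finset.sum_mul, trace_sum]

/-- Concavity property of covariance matrices: for a convex combination
ρ = Σ_k p_k ρ_k one has γ(ρ) ≥ Σ_k p_k γ(ρ_k), and likewise for γ^S. -/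
theorem covMat_concavity {d N m : ℕ}
    (M : Fin N → Matrix (Fin d) (Fin d) ℂ) (hHerm : ∀ k, (M k).IsHermitian)
    (ρs : Fin m → Matrix (Fin d) (Fin d) ℂ)
    (hρs : ∀ k, (ρs k).PosSemidef) (hρs1 : ∀ k, (ρs k).trace = 1)
    (p : Fin m → ℝ) (hp : ∀ k, 0 ≤ p k) (hp1 : ∑ k, p k = 1) :
    (covMat (∑ k, (p k : ℂ) • ρs k) M - ∑ k, (p k : ℂ) • covMat (ρs k) M).PosSemidef ∧
    (symCovMat (∑ k, (p k : ℂ) • ρs k) M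
        - ∑ k, (p k : ℂ) • symCovMat (ρs k) M).PosSemidef := by
  have key := posSemidef_classicalCov p hp hp1 (fun k i => expVal (ρs k) (M i))
    fun k i => star_expVal (hρs k).isHermitian (hHerm i)
  constructor
  · convert key using 1
    ext i j
    simp only [covMat, expVal_sum_smul, Matrix.sub_apply, Matrix.of_apply, Matrix.sum_apply,
      Matrix.smul_apply, smul_eq_mul, mul_sub, Finset.sum_sub_distrib]
    ring
  · convert key using 1
    ext i j
    simp only [symCovMat, expVal_sum_smul, Matrix.sub_apply, Matrix.of_apply, Matrix.sum_apply,
      Matrix.smul_apply, smul_eq_mul, mul_sub, mul_div_assoc', mul_add, Finset.sum_sub_distrib,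
      ← Finset.sum_div, Finset.sum_add_distrib]
    ring
end
end

section
/- (Filter CMC) Let d ≥ 1, let (Ĝ_k^A)_{k=1,…,d²−1} and (Ĝ_k^B)_{k=1,…,d²−1} be families of traceless Hermitian d×d matrices with tr(Ĝ_k^A Ĝ_l^A) = δ_{k,l} and tr(Ĝ_k^B Ĝ_l^B) = δ_{k,l}, and let ξ_k ≥ 0 be such that ρ = (1/d²)(1 ⊗ 1 + Σ_{k=1}^{d²−1} ξ_k Ĝ_k^A ⊗ Ĝ_k^B) is a density matrix in filter normal form. If ρ is separable, then Σ_{k=1}^{d²−1} ξ_k ≤ d² − d. -/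
open Matrix BigOperators
open scoped ComplexOrder Kronecker

noncomputable section

/-- A bipartite state (tensor products realized by Kronecker products) is
separable if it is a convex combination of pure product states. -/
def Separable {dA dB : ℕ}
    (ρ : Matrix (Fin dA × Fin dB) (Fin dA × Fin dB) ℂ) : Prop :=
  ∃ (m : ℕ) (p : Fin m → ℝ) (a : Fin m → Fin dA → ℂ) (b : Fin m → Fin dB → ℂ),
    (∀ k, 0 ≤ p k) ∧ (∑ k, p k = 1) ∧
    (∀ k, star (a k) ⬝ᵥ a k = 1) ∧ (∀ k, star (b k) ⬝ᵥ b k = 1) ∧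
    ρ = ∑ k, (p k : ℂ) •
      (vecMulVec (a k) (star (a k)) ⊗ₖ vecMulVec (b k) (star (b k)))

/-- The trace of a product of two Hermitian matrices is real. -/
theorem Matrix.IsHermitian.ofReal_re_trace_mul {n : Type*} [Fintype n] {X Y : Matrix n n ℂ}
    (hX : X.IsHermitian) (hY : Y.IsHermitian) :
    (((X * Y).trace.re : ℝ) : ℂ) = (X * Y).trace := by
  apply Complex.conj_eq_iff_re.mp
  rw [starRingEnd_apply, ← trace_conjTranspose, conjTranspose_mul, hX.eq, hY.eq, trace_mul_comm]

/-- Bessel's inequality for the Hilbert–Schmidt inner product on Hermitian matrices. -/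
theorem Matrix.IsHermitian.sum_sq_re_trace_mul_le {n ι : Type*} [Fintype n] [Fintype ι]
    [DecidableEq ι] {Y : Matrix n n ℂ} (hY : Y.IsHermitian) {G : ι → Matrix n n ℂ}
    (hG : ∀ k, (G k).IsHermitian)
    (hON : ∀ k l, (G k * G l).trace = if k = l then 1 else 0) :
    ∑ k, (Y * G k).trace.re ^ 2 ≤ (Y * Y).trace.re := by
  classical
  set x : ι → ℝ := fun k => (Y * G k).trace.re
  have hYG : ∀ k, (Y * G k).trace = (x k : ℂ) := fun k => (hY.ofReal_re_trace_mul (hG k)).symm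
  set S : Matrix n n ℂ := ∑ k, (x k : ℂ) • G k with hS
  have hSH : S.IsHermitian := by
    simp only [IsHermitian, hS, conjTranspose_sum, conjTranspose_smul, (hG _).eq,
      Complex.star_def, Complex.conj_ofReal]
  have hYS : (Y * S).trace = ((∑ k, x k ^ 2 : ℝ) : ℂ) := by
    simp [hS, Finset.mul_sum, trace_sum, hYG, pow_two]
  have hSY : (S * Y).trace = ((∑ k, x k ^ 2 : ℝ) : ℂ) := by
    rw [trace_mul_comm, hYS]
  have hSS : (S * S).trace = ((∑ k, x k ^ 2 : ℝ) : ℂ) := by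
    simp [hS, Finset.mul_sum, Finset.sum_mul, trace_sum, hON, pow_two]
  have h0 : 0 ≤ ((Y - S)ᴴ * (Y - S)).trace := (posSemidef_conjTranspose_mul_self _).trace_nonneg
  rw [(hY.sub hSH).eq, sub_mul, mul_sub, mul_sub, trace_sub, trace_sub, trace_sub, hYS, hSY,
    hSS, sub_self, sub_zero] at h0
  have h1 := (Complex.le_def.mp h0).1
  rw [Complex.sub_re, Complex.ofReal_re, Complex.zero_re] at h1
  linarith

theorem isHermitian_vecMulVec_star {n : Type*} (a : n → ℂ) :
    (vecMulVec a (star a)).IsHermitian := by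
  simp [IsHermitian, conjTranspose_vecMulVec]

/-- For a pure state, the squared expectation values of traceless Hilbert–Schmidt orthonormal
observables sum to at most `1 - 1 / d`. -/
theorem sum_sq_re_trace_pure_mul_le {d : ℕ} (hd : 1 ≤ d) {ι : Type*} [Fintype ι] [DecidableEq ι]
    {G : ι → Matrix (Fin d) (Fin d) ℂ} (hG : ∀ k, (G k).IsHermitian)
    (htr : ∀ k, (G k).trace = 0)
    (hON : ∀ k l, (G k * G l).trace = if k = l then 1 else 0)
    {a : Fin d → ℂ} (ha : star a ⬝ᵥ a = 1) :
    ∑ k, (vecMulVec a (star a) * G k).trace.re ^ 2 ≤ 1 - (d : ℝ)⁻¹ := by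
  have hd0 : (d : ℂ) ≠ 0 := by exact_mod_cast (by omega : d ≠ 0)
  set P := vecMulVec a (star a) with hP
  have hPtr : P.trace = 1 := by rw [hP, trace_vecMulVec, dotProduct_comm, ha]
  have hPP : P * P = P := by rw [hP, vecMulVec_mul_vecMulVec, ha, one_smul]
  have hYH : (P - ((d : ℂ)⁻¹) • (1 : Matrix (Fin d) (Fin d) ℂ)).IsHermitian := by
    refine (isHermitian_vecMulVec_star a).sub ?_
    simp [IsHermitian, conjTranspose_smul]
  have h := hYH.sum_sq_re_trace_mul_le hG hON
  have hYY : ((P - ((d : ℂ)⁻¹) • (1 : Matrix (Fin d) (Fin d) ℂ)) *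
      (P - ((d : ℂ)⁻¹) • (1 : Matrix (Fin d) (Fin d) ℂ))).trace
      = ((1 - (d : ℝ)⁻¹ : ℝ) : ℂ) := by
    simp [sub_mul, mul_sub, hPP, hPtr, hd0]
  rw [hYY, Complex.ofReal_re] at h
  simpa [sub_mul, htr] using h

/-- The filter CMC: if a state in filter normal form
ρ = (1/d²)(1⊗1 + Σ_k ξ_k Ĝ_k^A ⊗ Ĝ_k^B), with traceless Hilbert–Schmidt
orthonormal Hermitian Ĝ_k^A, Ĝ_k^B and ξ_k ≥ 0, is separable, then
Σ_k ξ_k ≤ d² − d. -/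
theorem filter_cmc {d : ℕ} (hd : 1 ≤ d)
    (GA : Fin (d ^ 2 - 1) → Matrix (Fin d) (Fin d) ℂ)
    (hGAH : ∀ k, (GA k).IsHermitian)
    (hGAtr : ∀ k, (GA k).trace = 0)
    (hGAON : ∀ k l, (GA k * GA l).trace = if k = l then 1 else 0)
    (GB : Fin (d ^ 2 - 1) → Matrix (Fin d) (Fin d) ℂ)
    (hGBH : ∀ k, (GB k).IsHermitian)
    (hGBtr : ∀ k, (GB k).trace = 0)
    (hGBON : ∀ k l, (GB k * GB l).trace = if k = l then 1 else 0)
    (ξ : Fin (d ^ 2 - 1) → ℝ) (hξ : ∀ k, 0 ≤ ξ k)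
    (ρ : Matrix (Fin d × Fin d) (Fin d × Fin d) ℂ)
    (hρ : ρ = ((d : ℂ) ^ 2)⁻¹ •
      ((1 : Matrix (Fin d × Fin d) (Fin d × Fin d) ℂ)
        + ∑ k, (ξ k : ℂ) • (GA k ⊗ₖ GB k)))
    (hρPSD : ρ.PosSemidef) (hρ1 : ρ.trace = 1)
    (hsep : Separable ρ) :
    ∑ k, ξ k ≤ (d : ℝ) ^ 2 - d := by
  obtain ⟨m, p, a, b, hp, hp1, ha, hb, hs⟩ := hsep
  have hd0 : (d : ℝ) ≠ 0 := by exact_mod_cast (by omega : d ≠ 0)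
  have hd0' : (d : ℂ) ≠ 0 := by exact_mod_cast (by omega : d ≠ 0)
  set x : Fin m → Fin (d ^ 2 - 1) → ℝ :=
    fun j k => (vecMulVec (a j) (star (a j)) * GA k).trace.re
  set y : Fin m → Fin (d ^ 2 - 1) → ℝ :=
    fun j k => (vecMulVec (b j) (star (b j)) * GB k).trace.re
  have hxc : ∀ j k, (vecMulVec (a j) (star (a j)) * GA k).trace = (x j k : ℂ) := fun j k =>
    ((isHermitian_vecMulVec_star (a j)).ofReal_re_trace_mul (hGAH k)).symm
  have hyc : ∀ j k, (vecMulVec (b j) (star (b j)) * GB k).trace = (y j k : ℂ) := fun j k =>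
    ((isHermitian_vecMulVec_star (b j)).ofReal_re_trace_mul (hGBH k)).symm
  have hξk : ∀ k, ξ k = (d : ℝ) ^ 2 * ∑ j, p j * (x j k * y j k) := by
    intro k
    have h1 : (ρ * (GA k ⊗ₖ GB k)).trace = ((d : ℂ) ^ 2)⁻¹ * ξ k := by
      simp [hρ, add_mul, Finset.sum_mul, trace_sum, ← mul_kronecker_mul, trace_kronecker,
        hGAtr, hGAON, hGBON]
    have h2 : (ρ * (GA k ⊗ₖ GB k)).trace = ∑ j, (p j : ℂ) * (x j k * y j k) := by
      simp only [hs, Finset.sum_mul, trace_sum, smul_mul_assoc, trace_smul, ← mul_kronecker_mul,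
        trace_kronecker, hxc, hyc, smul_eq_mul]
    have h3 : (ξ k : ℂ) = (d : ℂ) ^ 2 * ∑ j, (p j : ℂ) * (x j k * y j k) := by
      rw [← h2, h1, mul_inv_cancel_left₀ (pow_ne_zero 2 hd0')]
    exact_mod_cast h3
  have hxy : ∀ j, ∑ k, x j k * y j k ≤ 1 - (d : ℝ)⁻¹ := by
    intro j
    have h1 : ∑ k, x j k ^ 2 ≤ 1 - (d : ℝ)⁻¹ :=
      sum_sq_re_trace_pure_mul_le hd hGAH hGAtr hGAON (ha j)
    have h2 : ∑ k, y j k ^ 2 ≤ 1 - (d : ℝ)⁻¹ :=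
      sum_sq_re_trace_pure_mul_le hd hGBH hGBtr hGBON (hb j)
    have h3 : ∑ k, 2 * (x j k * y j k) ≤ ∑ k, (x j k ^ 2 + y j k ^ 2) :=
      Finset.sum_le_sum fun k _ => by nlinarith [sq_nonneg (x j k - y j k)]
    rw [← Finset.mul_sum, Finset.sum_add_distrib] at h3
    linarith
  calc ∑ k, ξ k = (d : ℝ) ^ 2 * ∑ j, p j * ∑ k, x j k * y j k := by
        simp only [hξk, ← Finset.mul_sum]
        rw [Finset.sum_comm]
        simp only [Finset.mul_sum]
    _ ≤ (d : ℝ) ^ 2 * ∑ j, p j * (1 - (d : ℝ)⁻¹) := by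
        gcongr with j
        · exact hp j
        · exact hxy j
    _ = (d : ℝ) ^ 2 - d := by
        rw [← Finset.sum_mul, hp1]
        field_simp
end
end
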